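/- Let K ≥ 2 be an integer and let ψ : ℕ → (0, ∞) be monotonically decreasing with Σ_{q=1}^{∞} q^{K−2}·ψ(q) = ∞. Then the set 𝒜_{K−1}(ψ) of tuples (h_1, ..., h_{K−1}) ∈ ℝ^{K−1} such that the inequality |p + q_1·h_1 + q_2·h_2 + ... + q_{K−1}·h_{K−1}| < ψ(|q|_∞) holds for infinitely many pairs (p, q) with p ∈ ℤ and q = (q_1, ..., q_{K−1}) ∈ ℤ^{K−1} \ {0} has full Lebesgue measure, i.e., its complement ℝ^{K−1} \ 𝒜_{K−1}(ψ) has (K−1)-dimensional Lebesgue measure zero. -/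

import Mathlib

open MeasureTheory Filter Topology Finset

/-- second moment -/
theorem kg_second_moment {Ω ι : Type*} [MeasurableSpace Ω] (μ : Measure Ω) [IsFiniteMeasure μ]
    (A : ι → Set Ω) (hA : ∀ i, MeasurableSet (A i)) (s : ℕ → Finset ι) (C : ℝ) (hC : 0 < C)
    (hM : Tendsto (fun N => ∑ i ∈ s N, μ.real (A i)) atTop atTop)
    (h2 : ∀ N, ∑ i ∈ s N, ∑ j ∈ s N, μ.real (A i ∩ A j) ≤
      C * (∑ i ∈ s N, μ.real (A i)) ^ 2 + ∑ i ∈ s N, μ.real (A i)) :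
    ∃ S : Set Ω, MeasurableSet S ∧ S ⊆ {x | {i | x ∈ A i}.Infinite} ∧ 1 ≤ C * μ.real S := by
  classical
  set M : ℕ → ℝ := fun N => ∑ i ∈ s N, μ.real (A i) with hMdef
  let F : ℕ → Ω → ℝ := fun N x => ∑ i ∈ s N, (A i).indicator (fun _ => (1 : ℝ)) x
  have hFm : ∀ N, Measurable (F N) := fun N =>
    Finset.measurable_sum _ fun i _ => measurable_const.indicator (hA i)
  let G : ℕ → Set Ω := fun T => {x | ∃ N, (T : ℝ) < F N x}
  have hGm : ∀ T, MeasurableSet (G T) := by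
    intro T
    have : G T = ⋃ N, {x | (T : ℝ) < F N x} := by ext; simp [G]
    rw [this]
    exact MeasurableSet.iUnion fun N => measurableSet_lt measurable_const (hFm N)
  have hind : ∀ B : Set Ω, MeasurableSet B → Integrable (B.indicator (fun _ => (1 : ℝ))) μ :=
    fun B hB => (integrable_const _).indicator hB
  have hindI : ∀ B : Set Ω, MeasurableSet B → ∫ x, B.indicator (fun _ => (1 : ℝ)) x ∂μ = μ.real B :=
    fun B hB => by rw [integral_indicator hB]; simp
  have hFI : ∀ N, Integrable (F N) μ := fun N => integrable_finsetSum _ fun i _ => hind _ (hA i)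
  have hFM : ∀ N, ∫ x, F N x ∂μ = M N := by
    intro N
    simp only [F]
    rw [integral_finsetSum _ fun i _ => hind _ (hA i)]
    exact Finset.sum_congr rfl fun i _ => hindI _ (hA i)
  have hF2 : ∀ N, (fun x => F N x ^ 2) = fun x =>
      ∑ i ∈ s N, ∑ j ∈ s N, (A i ∩ A j).indicator (fun _ => (1 : ℝ)) x := by
    intro N; ext x
    simp only [F, sq, Finset.sum_mul_sum]
    refine Finset.sum_congr rfl fun i _ => Finset.sum_congr rfl fun j _ => ?_
    by_cases h1 : x ∈ A i <;> by_cases h2 : x ∈ A j <;> simp [h1, h2]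
  have hF2I : ∀ N, Integrable (fun x => F N x ^ 2) μ := by
    intro N; rw [hF2]
    exact integrable_finsetSum _ fun i _ => integrable_finsetSum _ fun j _ =>
      hind _ ((hA i).inter (hA j))
  have hF2M : ∀ N, ∫ x, F N x ^ 2 ∂μ = ∑ i ∈ s N, ∑ j ∈ s N, μ.real (A i ∩ A j) := by
    intro N
    rw [hF2, integral_finsetSum _ fun i _ => integrable_finsetSum _ fun j _ =>
      hind _ ((hA i).inter (hA j))]
    refine Finset.sum_congr rfl fun i _ => ?_
    rw [integral_finsetSum _ fun j _ => hind _ ((hA i).inter (hA j))]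
    exact Finset.sum_congr rfl fun j _ => hindI _ ((hA i).inter (hA j))
  have key : ∀ T N : ℕ, 2 * (C * M N) * M N ≤ (C * M N ^ 2 + M N) +
      (C * M N) ^ 2 * μ.real (G T) + 2 * (C * M N) * T * μ.real Set.univ := by
    intro T N
    have hM0 : 0 ≤ M N := Finset.sum_nonneg fun i _ => measureReal_nonneg
    have hpt : ∀ x, 2 * (C * M N) * F N x ≤ F N x ^ 2 +
        (C * M N) ^ 2 * (G T).indicator (fun _ => (1 : ℝ)) x + 2 * (C * M N) * T := by
      intro x
      have h0 : 0 ≤ 2 * (C * M N) := by positivity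
      by_cases hx : x ∈ G T
      · have h1 : 0 ≤ 2 * (C * M N) * T := by positivity
        simp only [hx, Set.indicator_of_mem]
        nlinarith [sq_nonneg (F N x - C * M N)]
      · have h1 : F N x ≤ T := by
          by_contra h; exact hx ⟨N, not_le.1 h⟩
        simp only [hx, Set.indicator_of_notMem, not_false_eq_true]
        nlinarith [sq_nonneg (F N x), mul_le_mul_of_nonneg_left h1 h0]
    have := integral_mono (μ := μ) ((hFI N).const_mul _)
      (((hF2I N).add ((hind _ (hGm T)).const_mul _)).add (integrable_const _)) hpt
    simp only [Pi.add_apply] at this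
    rw [integral_const_mul, hFM, integral_add, integral_add, hF2M, integral_const_mul,
      hindI _ (hGm T), integral_const] at this
    · have h3 := h2 N
      rw [smul_eq_mul] at this
      linarith
    · exact hF2I N
    · exact (hind _ (hGm T)).const_mul _
    · exact (hF2I N).add ((hind _ (hGm T)).const_mul _)
    · exact integrable_const _
  have hGT : ∀ T, 1 ≤ C * μ.real (G T) := by
    intro T
    have hinv : Tendsto (fun N => (M N)⁻¹) atTop (𝓝 0) := hM.inv_tendsto_atTop
    have hlim : Tendsto (fun N => (C + (M N)⁻¹) + C ^ 2 * μ.real (G T) +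
        2 * C * T * μ.real Set.univ * (M N)⁻¹) atTop
        (𝓝 ((C + 0) + C ^ 2 * μ.real (G T) + 2 * C * T * μ.real Set.univ * 0)) :=
      ((hinv.const_add C).add_const _).add (hinv.const_mul _)
    have hle : 2 * C ≤ (C + 0) + C ^ 2 * μ.real (G T) + 2 * C * T * μ.real Set.univ * 0 := by
      refine ge_of_tendsto hlim ?_
      filter_upwards [hM.eventually_gt_atTop 0] with N hN
      have hN' : 0 < M N := hN
      have := key T N
      have h4 : 2 * C * M N ^ 2 ≤ ((C + (M N)⁻¹) + C ^ 2 * μ.real (G T) +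
        2 * C * T * μ.real Set.univ * (M N)⁻¹) * M N ^ 2 := by
        have e : ((C + (M N)⁻¹) + C ^ 2 * μ.real (G T) +
          2 * C * T * μ.real Set.univ * (M N)⁻¹) * M N ^ 2 = (C * M N ^ 2 + M N) +
      (C * M N) ^ 2 * μ.real (G T) + 2 * (C * M N) * T * μ.real Set.univ := by
          field_simp
        rw [e]; linarith
      exact le_of_mul_le_mul_right h4 (by positivity)
    have : C * 1 ≤ C * (C * μ.real (G T)) := by nlinarith
    exact le_of_mul_le_mul_left this hC
  have hanti : Antitone G := by
    intro a b hab x ⟨N, hN⟩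
    exact ⟨N, lt_of_le_of_lt (by exact_mod_cast hab) hN⟩
  have hlim := tendsto_measure_iInter_atTop (μ := μ) (fun T => (hGm T).nullMeasurableSet) hanti
    ⟨0, measure_ne_top _ _⟩
  have hlim' : Tendsto (fun T => μ.real (G T)) atTop (𝓝 (μ.real (⋂ T, G T))) :=
    (ENNReal.tendsto_toReal (measure_ne_top _ _)).comp hlim
  have h5 : 1 ≤ C * μ.real (⋂ T, G T) := ge_of_tendsto' (hlim'.const_mul C) hGT
  refine ⟨_, MeasurableSet.iInter hGm, ?_, h5⟩
  intro x hx
  by_contra hfin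
  have hfin' : {i | x ∈ A i}.Finite := Set.not_infinite.1 hfin
  obtain ⟨N, hN⟩ := Set.mem_iInter.1 hx hfin'.toFinset.card
  refine absurd hN (not_lt.2 ?_)
  simp only [F, Set.indicator_apply, Finset.sum_boole]
  norm_cast
  refine Finset.card_le_card fun i hi => ?_
  simpa using (Finset.mem_filter.1 hi).2

theorem kg_abel (f a : ℕ → ℝ) (hf : Antitone f) (hf0 : ∀ n, 0 ≤ f n)
    (ha : ∀ M, 0 ≤ ∑ m ∈ Icc 1 M, a m) (M : ℕ) : 0 ≤ ∑ m ∈ Icc 1 M, a m * f m := by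
  have : ∀ M, f M * ∑ m ∈ Icc 1 M, a m ≤ ∑ m ∈ Icc 1 M, a m * f m := by
    intro M
    induction M with
    | zero => simp
    | succ M ih =>
      rw [Finset.sum_Icc_succ_top (by omega), Finset.sum_Icc_succ_top (by omega)]
      have := mul_le_mul_of_nonneg_right (hf (Nat.le_succ M)) (ha M)
      simp only [Nat.succ_eq_add_one] at this
      nlinarith
  exact (mul_nonneg (hf0 M) (ha M)).trans (this M)

theorem kg_tot1 (M : ℕ) : ∑ m ∈ Icc 1 M, m.totient * (M / m) = ∑ m ∈ Icc 1 M, m := by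
  induction M with
  | zero => simp
  | succ M ih =>
    rw [Finset.sum_Icc_succ_top (b := M) (f := fun m => m) (by omega), ← ih]
    have h1 : ∀ m ∈ Icc 1 (M+1), m.totient * ((M + 1) / m) =
        m.totient * (M / m) + if m ∣ M + 1 then m.totient else 0 := by
      intro m _
      rw [Nat.succ_div]; split_ifs <;> ring
    rw [Finset.sum_congr rfl h1, Finset.sum_add_distrib, Finset.sum_Icc_succ_top (by omega),
      Nat.div_eq_of_lt (Nat.lt_succ_self M), mul_zero, add_zero, ← Finset.sum_filter]
    congr 1
    conv_rhs => rw [← Nat.sum_totient (M+1)]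
    apply Finset.sum_congr _ (fun _ _ => rfl)
    ext d
    simp only [Finset.mem_filter, Finset.mem_Icc, Nat.mem_divisors]
    constructor
    · rintro ⟨_, h⟩; exact ⟨h, by omega⟩
    · rintro ⟨h, _⟩; exact ⟨⟨Nat.pos_of_dvd_of_pos h (by omega), Nat.le_of_dvd (by omega) h⟩, h⟩

theorem kg_tot2 (M : ℕ) : (M : ℝ) / 2 ≤ ∑ m ∈ Icc 1 M, (m.totient : ℝ) / m := by
  rcases Nat.eq_zero_or_pos M with rfl | hM
  · simp
  have h1 : (∑ m ∈ Icc 1 M, (m : ℝ)) = M * (M + 1) / 2 := by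
    clear hM
    induction M with
    | zero => simp
    | succ M ih => rw [Finset.sum_Icc_succ_top (by omega), ih]; push_cast; ring
  have h2 : (∑ m ∈ Icc 1 M, (m : ℝ)) ≤ ∑ m ∈ Icc 1 M, (m.totient : ℝ) / m * M := by
    have := kg_tot1 M
    have h3 : (∑ m ∈ Icc 1 M, (m : ℝ)) = ∑ m ∈ Icc 1 M, (m.totient : ℝ) * ((M / m : ℕ) : ℝ) := by
      rw [← Nat.cast_sum, ← this]; push_cast; rfl
    rw [h3]
    refine Finset.sum_le_sum fun m _ => ?_
    rw [div_mul_eq_mul_div, mul_div_assoc]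
    exact mul_le_mul_of_nonneg_left Nat.cast_div_le (by positivity)
  rw [← Finset.sum_mul, h1] at h2
  have hM' : (0 : ℝ) < M := by exact_mod_cast hM
  have : (M : ℝ) / 2 * M ≤ (∑ m ∈ Icc 1 M, (m.totient : ℝ) / m) * M := by nlinarith
  exact le_of_mul_le_mul_right this hM'

theorem kg_tot3 (k M : ℕ) : ((M : ℝ) / 4) ^ (k + 1) ≤
    ∑ m ∈ Icc 1 M, (m.totient : ℝ) / m * (m : ℝ) ^ k := by
  have h1 : ∀ m ∈ Icc 1 M, ((M : ℝ) / 4) ^ k *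
      ((m.totient : ℝ) / m - if m ≤ M / 4 then 1 else 0) ≤ (m.totient : ℝ) / m * (m : ℝ) ^ k := by
    intro m hm
    have hm1 := (Finset.mem_Icc.1 hm).1
    have hm0 : (0 : ℝ) < m := by exact_mod_cast hm1
    have hg0 : 0 ≤ (m.totient : ℝ) / m := by positivity
    have hg1 : (m.totient : ℝ) / m ≤ 1 := by
      rw [div_le_one hm0]; exact_mod_cast Nat.totient_le m
    split_ifs with h
    · refine le_trans ?_ (by positivity : (0:ℝ) ≤ _)
      exact mul_nonpos_of_nonneg_of_nonpos (by positivity) (by linarith)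
    · rw [sub_zero, mul_comm]
      refine mul_le_mul_of_nonneg_left (pow_le_pow_left₀ (by positivity) ?_ _) hg0
      have : M ≤ 4 * m := by omega
      have : (M : ℝ) ≤ 4 * m := by exact_mod_cast this
      linarith
  refine le_trans ?_ (Finset.sum_le_sum h1)
  rw [← Finset.mul_sum, pow_succ, Finset.sum_sub_distrib, Finset.sum_boole]
  refine mul_le_mul_of_nonneg_left ?_ (by positivity)
  have h2 : (((Icc 1 M).filter (fun m => m ≤ M / 4)).card : ℝ) ≤ M / 4 := by
    have : ((Icc 1 M).filter (fun m => m ≤ M / 4)).card ≤ M / 4 := by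
      refine (Finset.card_le_card (t := Icc 1 (M/4)) ?_).trans (by simp)
      intro m hm
      simp at hm ⊢; omega
    calc _ ≤ ((M / 4 : ℕ) : ℝ) := by exact_mod_cast this
      _ ≤ _ := Nat.cast_div_le
  have := kg_tot2 M
  linarith

theorem kg_tot4 (k : ℕ) (f : ℕ → ℝ) (hf : Antitone f) (hf0 : ∀ n, 0 ≤ f n) (M : ℕ) :
    (1 / 4 : ℝ) ^ (k + 1) * ∑ m ∈ Icc 1 M, (m : ℝ) ^ k * f m ≤
      ∑ m ∈ Icc 1 M, (m.totient : ℝ) / m * (m : ℝ) ^ k * f m := by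
  have := kg_abel f (fun m => (m.totient : ℝ) / m * (m : ℝ) ^ k - (1 / 4 : ℝ) ^ (k + 1) * (m : ℝ) ^ k)
    hf hf0 (fun M => ?_) M
  · simp only [sub_mul, Finset.sum_sub_distrib] at this
    rw [Finset.mul_sum]
    simp only [mul_assoc] at this ⊢
    linarith
  · rw [Finset.sum_sub_distrib, ← Finset.mul_sum]
    have h1 := kg_tot3 k M
    have h2 : ∑ m ∈ Icc 1 M, (m : ℝ) ^ k ≤ (M : ℝ) ^ (k + 1) := by
      calc _ ≤ ∑ m ∈ Icc 1 M, (M : ℝ) ^ k := Finset.sum_le_sum fun m hm => by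
            have := (Finset.mem_Icc.1 hm).2
            gcongr
        _ = _ := by simp; ring
    have h3 : ((M : ℝ) / 4) ^ (k + 1) = (1 / 4) ^ (k + 1) * (M : ℝ) ^ (k + 1) := by
      rw [← mul_pow]; ring
    have := mul_le_mul_of_nonneg_left h2 (by positivity : (0:ℝ) ≤ (1 / 4) ^ (k + 1))
    linarith

/-- truncated function still diverges -/
theorem kg_trunc (k : ℕ) (ψ : ℕ → ℝ) (hψ : ∀ q, 0 < ψ q) (hmono : Antitone ψ)
    (hdiv : ¬ Summable (fun q : ℕ => (q : ℝ) ^ k * ψ q)) :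
    ∃ ρ : ℕ → ℝ, Antitone ρ ∧ (∀ q, 0 < ρ q) ∧ (∀ q, ρ q < ψ q) ∧ (∀ q, ρ q ≤ 1 / 2) ∧
      Tendsto (fun N : ℕ => ∑ m ∈ Icc 1 N, (m.totient : ℝ) / m * (m : ℝ) ^ k * ρ m) atTop atTop := by
  refine ⟨fun q => min (ψ q) 1 / 2, ?_, ?_, ?_, ?_, ?_⟩
  · intro a b hab
    have := min_le_min_right 1 (hmono hab)
    dsimp only; linarith
  · intro q; have := lt_min (hψ q) one_pos; dsimp only; linarith
  · intro q; have := min_le_left (ψ q) 1; have := hψ q; dsimp only; linarith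
  · intro q; have := min_le_right (ψ q) 1; dsimp only; linarith
  set ρ : ℕ → ℝ := fun q => min (ψ q) 1 / 2 with hρ
  have hρa : Antitone ρ := by
    intro a b hab
    have := min_le_min_right 1 (hmono hab)
    simp only [hρ]; linarith
  have hρ0 : ∀ q, 0 < ρ q := by intro q; have := lt_min (hψ q) one_pos; simp only [hρ]; linarith
  have hns : ¬ Summable (fun q : ℕ => (q : ℝ) ^ k * ρ q) := by
    intro hs
    by_cases h : ∃ q0, ψ q0 ≤ 1
    · obtain ⟨q0, hq0⟩ := h
      apply hdiv
      rw [← summable_nat_add_iff q0] at hs ⊢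
      refine (hs.mul_left 2).congr fun q => ?_
      have : ψ (q + q0) ≤ 1 := (hmono (by omega)).trans hq0
      simp only [hρ, min_eq_left this]; ring
    · push Not at h
      have h0 := hs.tendsto_atTop_zero
      have : ∀ᶠ q : ℕ in atTop, (1/2 : ℝ) ≤ (q : ℝ) ^ k * ρ q := by
        filter_upwards [eventually_ge_atTop 1] with q hq
        simp only [hρ, min_eq_right (h q).le]
        have : (1:ℝ) ≤ (q:ℝ) ^ k := one_le_pow₀ (by exact_mod_cast hq)
        linarith
      have := ge_of_tendsto h0 this
      norm_num at this
  have hnn : ∀ q : ℕ, 0 ≤ (q : ℝ) ^ k * ρ q := fun q => mul_nonneg (by positivity) (hρ0 q).le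
  have ht := (not_summable_iff_tendsto_nat_atTop_of_nonneg hnn).1 hns
  have ht' : Tendsto (fun N : ℕ => ∑ m ∈ Icc 1 N, (m : ℝ) ^ k * ρ m) atTop atTop := by
    have h1 := tendsto_atTop_add_const_right _ (-((0:ℕ) : ℝ) ^ k * ρ 0) ((tendsto_add_atTop_iff_nat 1).2 ht)
    refine h1.congr fun N => ?_
    rw [Finset.sum_range_succ', Finset.range_eq_Ico, Finset.sum_Ico_add' (fun m : ℕ => (m:ℝ)^k * ρ m) 0 N 1]
    have : Ico (0+1) (N+1) = Icc 1 N := by ext; simp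
    rw [this]; ring
  exact tendsto_atTop_mono (fun N => kg_tot4 k ρ hρa (fun q => (hρ0 q).le) N)
    (ht'.const_mul_atTop (by positivity))

/-- transfer from torus to reals -/
theorem kg_transfer (n : ℕ) (P : (Fin n → UnitAddCircle) → Prop) (h : ∀ᵐ x, P x) :
    ∀ᵐ y : Fin n → ℝ, P (fun k => (y k : UnitAddCircle)) := by
  have hb : ∀ t : Fin n → ℤ, ∀ᵐ y : Fin n → ℝ,
      y ∈ Set.univ.pi (fun k => Set.Ioc (t k : ℝ) (t k + 1)) → P (fun k => (y k : UnitAddCircle)) := by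
    intro t
    rw [← ae_restrict_iff' (MeasurableSet.univ_pi fun k => measurableSet_Ioc)]
    have h1 := measurePreserving_pi _ _ (fun i : Fin n => AddCircle.measurePreserving_mk 1 (t i : ℝ))
    rw [← Measure.restrict_pi_pi] at h1
    exact h1.quasiMeasurePreserving.ae h
  rw [← ae_all_iff] at hb
  filter_upwards [hb] with y hy
  refine hy (fun k => ⌈y k⌉ - 1) ?_
  intro k _
  push_cast
  exact ⟨by linarith [Int.ceil_lt_add_one (y k)], by linarith [Int.le_ceil (y k)]⟩

theorem kg_norm (x : ℝ) (r : ℝ) (h : ‖(x : UnitAddCircle)‖ < r) : ∃ p : ℤ, |(p : ℝ) + x| < r := by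
  rw [UnitAddCircle.norm_eq] at h
  exact ⟨-round x, by rw [abs_sub_comm] at h; convert h using 1; rw [abs_sub_comm]; push_cast; ring_nf⟩

/-- the linear form -/
noncomputable def kgL {n : ℕ} (q : Fin n → ℕ) : (Fin n → UnitAddCircle) →+ UnitAddCircle :=
  { toFun := fun x => ∑ k, q k • x k
    map_zero' := by simp
    map_add' := fun x y => by simp [Finset.sum_add_distrib] }

theorem kgL_cont {n : ℕ} (q : Fin n → ℕ) : Continuous (kgL q) := by
  change Continuous (fun x : Fin n → UnitAddCircle => ∑ k, q k • x k)
  fun_prop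

theorem kgL_apply {n : ℕ} (q : Fin n → ℕ) (y : Fin n → ℝ) :
    kgL q (fun k => (y k : UnitAddCircle)) = ((∑ k, (q k : ℝ) * y k : ℝ) : UnitAddCircle) := by
  change ∑ k, q k • ((y k : ℝ) : UnitAddCircle) = _
  have h : ∀ x : ℝ, (x : UnitAddCircle) = QuotientAddGroup.mk' (AddSubgroup.zmultiples (1 : ℝ)) x :=
    fun _ => rfl
  simp only [h, map_sum, ← nsmul_eq_mul, map_nsmul]

theorem kg_vol (n : ℕ) : volume (Set.univ : Set (Fin n → UnitAddCircle)) = 1 := by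
  rw [volume_pi, ← Set.pi_univ, Measure.pi_pi]; simp

theorem kg_one {n : ℕ} (q : Fin n → ℕ) (i : Fin n) (hi : q i ≠ 0) (r : ℝ) (hr : r ≤ 1 / 2) (hr0 : 0 ≤ r):
    (volume : Measure (Fin n → UnitAddCircle)).real (kgL q ⁻¹' Metric.closedBall 0 r) = 2 * r := by
  have hs : Function.Surjective (kgL q) := by
    intro s
    induction s using QuotientAddGroup.induction_on with
    | H s =>
    refine ⟨fun k => ((Pi.single i (s / q i) : Fin n → ℝ) k : UnitAddCircle), ?_⟩
    rw [kgL_apply]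
    congr 1
    rw [Finset.sum_eq_single i]
    · simp; field_simp
    · intro j _ hj; simp [hj]
    · simp
  have := AddMonoidHom.measurePreserving (μ := volume) (ν := volume) (kgL_cont q) hs (by simp [kg_vol])
  rw [measureReal_def, this.measure_preimage measurableSet_closedBall.nullMeasurableSet,
    AddCircle.volume_closedBall, min_eq_right (by linarith), ENNReal.toReal_ofReal (by linarith)]

theorem kg_two {n : ℕ} (q q' : Fin n → ℕ) (i j : Fin n)
    (hd : (q i : ℝ) * q' j - q j * q' i ≠ 0) (r r' : ℝ)
    (hr : r ≤ 1 / 2) (hr0 : 0 ≤ r) (hr' : r' ≤ 1 / 2) (hr0' : 0 ≤ r') :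
    (volume : Measure (Fin n → UnitAddCircle)).real
      (kgL q ⁻¹' Metric.closedBall 0 r ∩ kgL q' ⁻¹' Metric.closedBall 0 r') = 2 * r * (2 * r') := by
  have hs : Function.Surjective ((kgL q).prod (kgL q')) := by
    rintro ⟨s, t⟩
    induction s using QuotientAddGroup.induction_on with
    | H s =>
    induction t using QuotientAddGroup.induction_on with
    | H t =>
    set D : ℝ := (q i : ℝ) * q' j - q j * q' i with hD
    let y : Fin n → ℝ := Pi.single i ((s * q' j - t * q j) / D) + Pi.single j ((t * q i - s * q' i) / D)
    have hy : ∀ c : Fin n → ℕ, ∑ k, (c k : ℝ) * y k =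
        c i * ((s * q' j - t * q j) / D) + c j * ((t * q i - s * q' i) / D) := by
      intro c
      simp only [y, Pi.add_apply, mul_add, Finset.sum_add_distrib]
      congr 1
      · rw [Finset.sum_eq_single i]
        · simp
        · intro j _ hj; simp [hj]
        · simp
      · rw [Finset.sum_eq_single j]
        · simp
        · intro j _ hj; simp [hj]
        · simp
    refine ⟨fun k => (y k : UnitAddCircle), ?_⟩
    rw [AddMonoidHom.prod_apply, kgL_apply, kgL_apply, hy, hy]
    congr 2
    · field_simp; rw [hD]; ring
    · field_simp; rw [hD]; ring
  have := AddMonoidHom.measurePreserving (μ := volume)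
    (ν := (volume : Measure UnitAddCircle).prod (volume : Measure UnitAddCircle))
    (f := (kgL q).prod (kgL q')) ((kgL_cont q).prodMk (kgL_cont q')) hs (by
      rw [kg_vol, ← Set.univ_prod_univ, Measure.prod_prod]; simp)
  have e : kgL q ⁻¹' Metric.closedBall 0 r ∩ kgL q' ⁻¹' Metric.closedBall 0 r' =
    ((kgL q).prod (kgL q')) ⁻¹' (Metric.closedBall 0 r ×ˢ Metric.closedBall 0 r') := by
    ext; simp
  rw [measureReal_def, e, this.measure_preimage
    (measurableSet_closedBall.prod measurableSet_closedBall).nullMeasurableSet, Measure.prod_prod,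
    AddCircle.volume_closedBall, AddCircle.volume_closedBall, min_eq_right (by linarith),
    min_eq_right (by linarith), ENNReal.toReal_mul,
    ENNReal.toReal_ofReal (by linarith), ENNReal.toReal_ofReal (by linarith)]

/-- index finset for the case of at least two forms variables -/
def kgS (m N : ℕ) : Finset (Σ _ : ℕ, ℕ × (Fin m → ℕ)) :=
  (Icc 1 N).sigma fun d => ((range d).filter (fun a => d.Coprime a)) ×ˢ
    Fintype.piFinset (fun _ : Fin m => range d)

def kgQ {m : ℕ} (i : Σ _ : ℕ, ℕ × (Fin m → ℕ)) : Fin (m + 2) → ℕ :=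
  Fin.cons i.1 (Fin.cons i.2.1 i.2.2)

theorem kgQ_inj {m : ℕ} : Function.Injective (kgQ (m := m)) := by
  rintro ⟨d, a, v⟩ ⟨d', a', v'⟩ h
  simp only [kgQ] at h
  obtain ⟨h1, h2⟩ := Fin.cons_inj.1 h
  obtain ⟨h2, h3⟩ := Fin.cons_inj.1 h2
  subst h1 h2 h3
  rfl

theorem kgS_mem {m N : ℕ} {i : Σ _ : ℕ, ℕ × (Fin m → ℕ)} (h : i ∈ kgS m N) :
    1 ≤ i.1 ∧ i.2.1 < i.1 ∧ i.1.Coprime i.2.1 ∧ ∀ k, i.2.2 k < i.1 := by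
  simp only [kgS, Finset.mem_sigma, Finset.mem_Icc, Finset.mem_product, Finset.mem_filter,
    Finset.mem_range, Fintype.mem_piFinset] at h
  tauto

theorem kgQ_det {m N : ℕ} {i i' : Σ _ : ℕ, ℕ × (Fin m → ℕ)} (h : i ∈ kgS m N) (h' : i' ∈ kgS m N)
    (hne : i ≠ i') : ∃ j : Fin (m + 2), 0 ≠ j ∧
      (kgQ i 0 : ℝ) * kgQ i' j - kgQ i j * kgQ i' 0 ≠ 0 := by
  by_contra hcon
  push Not at hcon
  have hall : ∀ j, kgQ i 0 * kgQ i' j = kgQ i j * kgQ i' 0 := by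
    intro j
    by_cases hj : 0 = j
    · subst hj; ring
    · have := hcon j hj
      have : (kgQ i 0 : ℝ) * kgQ i' j = kgQ i j * kgQ i' 0 := by linarith
      exact_mod_cast this
  obtain ⟨p1, -, p3, -⟩ := kgS_mem h
  obtain ⟨p1', -, p3', -⟩ := kgS_mem h'
  have h1 : i.1 * i'.2.1 = i.2.1 * i'.1 := hall 1
  have hd : i.1 ∣ i'.1 := p3.dvd_of_dvd_mul_left ⟨_, h1.symm⟩
  have hd' : i'.1 ∣ i.1 := p3'.dvd_of_dvd_mul_right ⟨i.2.1, by rw [h1]; ring⟩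
  have he : i.1 = i'.1 := Nat.dvd_antisymm hd hd'
  apply hne
  apply kgQ_inj
  funext j
  have := hall j
  have e0 : kgQ i 0 = i.1 := rfl
  have e0' : kgQ i' 0 = i.1 := he.symm
  rw [e0, e0', mul_comm] at this
  exact (Nat.eq_of_mul_eq_mul_right p1 this).symm

theorem kg_ge_two (m : ℕ) (ψ : ℕ → ℝ) (ρ : ℕ → ℝ) (hρ0 : ∀ q, 0 < ρ q) (hρψ : ∀ q, ρ q < ψ q)
    (hρ1 : ∀ q, ρ q ≤ 1 / 2)
    (hT : Tendsto (fun N : ℕ => ∑ d ∈ Icc 1 N, (d.totient : ℝ) / d * (d : ℝ) ^ (m + 1) * ρ d)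
      atTop atTop) :
    ∀ᵐ h : Fin (m + 2) → ℝ, {pq : ℤ × (Fin (m + 2) → ℤ) | pq.2 ≠ 0 ∧
        |(pq.1 : ℝ) + ∑ k, (pq.2 k : ℝ) * h k|
          < ψ (Finset.univ.sup fun k => (pq.2 k).natAbs)}.Infinite := by
  classical
  let A : (Σ _ : ℕ, ℕ × (Fin m → ℕ)) → Set (Fin (m+2) → UnitAddCircle) := fun i =>
    if ∃ N, i ∈ kgS m N then kgL (kgQ i) ⁻¹' Metric.closedBall 0 (ρ i.1) else ∅
  have hA : ∀ i, MeasurableSet (A i) := by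
    intro i
    simp only [A]; split_ifs
    · exact (kgL_cont _).measurable measurableSet_closedBall
    · exact MeasurableSet.empty
  have hAS : ∀ N, ∀ i ∈ kgS m N, A i = kgL (kgQ i) ⁻¹' Metric.closedBall 0 (ρ i.1) := by
    intro N i hi
    exact if_pos ⟨N, hi⟩
  have hA1 : ∀ N, ∀ i ∈ kgS m N, volume.real (A i) = 2 * ρ i.1 := by
    intro N i hi
    rw [hAS N i hi]
    refine kg_one _ 0 ?_ _ (hρ1 _) (hρ0 _).le
    have := (kgS_mem hi).1
    change i.1 ≠ 0
    omega
  have hA2 : ∀ N, ∀ i ∈ kgS m N, ∀ j ∈ kgS m N, i ≠ j →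
      volume.real (A i ∩ A j) = volume.real (A i) * volume.real (A j) := by
    intro N i hi j hj hij
    rw [hA1 N i hi, hA1 N j hj, hAS N i hi, hAS N j hj]
    obtain ⟨k, -, hk⟩ := kgQ_det hi hj hij
    exact kg_two _ _ 0 k hk _ _ (hρ1 _) (hρ0 _).le (hρ1 _) (hρ0 _).le
  have hsum : ∀ N, ∑ i ∈ kgS m N, volume.real (A i) =
      2 * ∑ d ∈ Icc 1 N, (d.totient : ℝ) / d * (d : ℝ) ^ (m + 1) * ρ d := by
    intro N
    rw [Finset.sum_congr rfl (hA1 N), kgS, Finset.sum_sigma, Finset.mul_sum]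
    refine Finset.sum_congr rfl fun d hd => ?_
    have hd0 : (d : ℝ) ≠ 0 := by
      have := (Finset.mem_Icc.1 hd).1
      positivity
    simp only [Finset.sum_const, nsmul_eq_mul, Finset.card_product, Fintype.card_piFinset,
      Finset.card_range, Finset.prod_const, Finset.card_univ, Fintype.card_fin]
    rw [← Nat.totient_eq_card_coprime]
    push_cast
    field_simp
    ring
  have hfin : IsFiniteMeasure (volume : Measure (Fin (m+2) → UnitAddCircle)) :=
    ⟨by rw [kg_vol]; exact ENNReal.one_lt_top⟩
  have hprob : IsProbabilityMeasure (volume : Measure (Fin (m+2) → UnitAddCircle)) := ⟨kg_vol _⟩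
  have key := kg_second_moment volume A hA (kgS m) 1 one_pos
    (by simp only [hsum]; exact hT.const_mul_atTop two_pos) (by
      intro N
      rw [one_mul, sq, Finset.sum_mul_sum, ← Finset.sum_add_distrib]
      refine Finset.sum_le_sum fun i hi => ?_
      rw [← Finset.add_sum_erase _ _ hi, ← Finset.add_sum_erase _ (fun j => _ * _) hi, Set.inter_self,
        Finset.sum_congr rfl (fun j hj => hA2 N i hi j (Finset.mem_of_mem_erase hj)
          (Finset.ne_of_mem_erase hj).symm)]
      have : 0 ≤ volume.real (A i) * volume.real (A i) := by positivity
      linarith)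
  obtain ⟨S, hSm, hSs, key⟩ := key
  have hae : ∀ᵐ x : Fin (m+2) → UnitAddCircle, {i | x ∈ A i}.Infinite := by
    have h0 := (prob_compl_eq_zero_iff (μ := (volume : Measure (Fin (m+2) → UnitAddCircle))) hSm).2 (by
      rw [one_mul] at key
      refine le_antisymm prob_le_one ?_
      rw [measureReal_def] at key
      have := ENNReal.ofReal_le_ofReal key
      rwa [ENNReal.ofReal_one, ENNReal.ofReal_toReal (measure_ne_top _ _)] at this)
    rw [ae_iff]
    exact measure_mono_null (fun x hx hxS => hx (hSs hxS)) h0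
  filter_upwards [kg_transfer _ _ hae] with y hy
  have hmem : ∀ i ∈ {i | (fun k => (y k : UnitAddCircle)) ∈ A i}, ∃ p : ℤ,
      (p, fun k => (kgQ i k : ℤ)) ∈ {pq : ℤ × (Fin (m + 2) → ℤ) | pq.2 ≠ 0 ∧
        |(pq.1 : ℝ) + ∑ k, (pq.2 k : ℝ) * y k|
          < ψ (Finset.univ.sup fun k => (pq.2 k).natAbs)} := by
    intro i hi
    have hex : ∃ N, i ∈ kgS m N := by
      by_contra hcon
      simp [A, hcon] at hi
    obtain ⟨N, hN⟩ := hex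
    rw [Set.mem_ofPred_eq, hAS N i hN, Set.mem_preimage, mem_closedBall_zero_iff, kgL_apply] at hi
    obtain ⟨p, hp⟩ := kg_norm _ _ (hi.trans_lt (hρψ _))
    obtain ⟨p1, p2, -, p4⟩ := kgS_mem hN
    refine ⟨p, ?_, ?_⟩
    · intro h0
      have : (kgQ i 0 : ℤ) = 0 := congrFun h0 0
      have : (i.1 : ℤ) = 0 := this
      omega
    · have hsup : (Finset.univ.sup fun k => (kgQ i k : ℤ).natAbs) = i.1 := by
        apply le_antisymm
        · refine Finset.sup_le fun k _ => ?_
          rw [Int.natAbs_natCast]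
          refine Fin.cases ?_ (fun k => Fin.cases ?_ (fun k => ?_) k) k
          · exact le_rfl
          · exact p2.le
          · exact (p4 k).le
        · exact Finset.le_sup (f := fun k => (kgQ i k : ℤ).natAbs) (Finset.mem_univ 0)
      simp only [hsup]
      exact_mod_cast hp
  choose! p hp using hmem
  refine Set.infinite_of_injOn_mapsTo (f := fun i => (p i, fun k => (kgQ i k : ℤ))) ?_ hp hy
  intro i _ j _ hij
  apply kgQ_inj
  have := (Prod.ext_iff.1 hij).2
  funext k
  have h1 : (kgQ i k : ℤ) = kgQ j k := congrFun this k
  exact_mod_cast h1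

theorem kg_count (q r : ℕ) (hq : 1 ≤ q) (hr : 1 ≤ r) (B : ℝ) (hB : 0 ≤ B) :
    ((((range q) ×ˢ (range r)).filter (fun p : ℕ × ℕ => p.1 * r ≠ p.2 * q ∧
      |(p.1 : ℝ) * r - p.2 * q| ≤ B)).card : ℝ) ≤ 2 * B := by
  set g := Nat.gcd q r with hg
  have hg0 : 0 < g := Nat.gcd_pos_of_pos_left _ hq
  obtain ⟨q', hq'⟩ : g ∣ q := Nat.gcd_dvd_left _ _
  obtain ⟨r', hr'⟩ : g ∣ r := Nat.gcd_dvd_right _ _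
  have hcop : Nat.Coprime q' r' := by
    have h := Nat.gcd_mul_left g q' r'
    rw [← hq', ← hr', ← hg] at h
    exact Nat.eq_of_mul_eq_mul_left hg0 (by rw [mul_one]; exact h.symm)
  have hq'0 : 0 < q' := by
    rcases Nat.eq_zero_or_pos q' with h | h
    · subst h; omega
    · exact h
  set T : ℤ := ⌊B / g⌋ with hT
  have hgR : (0 : ℝ) < g := by exact_mod_cast hg0
  have hT0 : 0 ≤ T := Int.floor_nonneg.2 (by positivity)
  have hcard : (((Icc (-T) T).erase 0 ×ˢ range g).card : ℝ) ≤ 2 * B := by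
    rw [Finset.card_product, Finset.card_erase_of_mem (by simp [hT0]), Int.card_Icc, Finset.card_range]
    have h1 : (T + 1 - -T).toNat - 1 = (2 * T).toNat := by omega
    rw [h1]
    have h2 : (((2 * T).toNat : ℕ) : ℝ) = 2 * T := by
      have : (((2 * T).toNat : ℕ) : ℤ) = 2 * T := Int.toNat_of_nonneg (by omega)
      exact_mod_cast this
    push_cast
    rw [h2]
    have h3 : (T : ℝ) ≤ B / g := Int.floor_le _
    rw [le_div_iff₀ hgR] at h3
    linarith
  refine le_trans ?_ hcard
  refine Nat.cast_le.2 ?_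
  refine Finset.card_le_card_of_injOn
    (fun p => ((p.1 : ℤ) * r' - p.2 * q', p.1 / q')) ?_ ?_
  · rintro ⟨a, b⟩ hab
    simp only [Finset.coe_filter, Finset.mem_product, Finset.mem_range, Set.mem_ofPred_eq] at hab
    obtain ⟨⟨ha, hb⟩, hne, hle⟩ := hab
    have e : (a : ℝ) * r - b * q = ((a : ℤ) * r' - b * q' : ℤ) * g := by
      rw [hq', hr']; push_cast; ring
    rw [e, abs_mul, abs_of_pos hgR, ← le_div_iff₀ hgR, ← Int.cast_abs, ← Int.le_floor, ← hT, abs_le] at hle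
    simp only [Finset.coe_product, Set.mem_prod, Finset.mem_coe, Finset.mem_erase, Finset.mem_Icc,
      Finset.mem_range]
    refine ⟨⟨?_, hle⟩, ?_⟩
    · intro h0
      apply hne
      have : (a : ℤ) * r = b * q := by
        rw [hq', hr']; push_cast
        linear_combination (g : ℤ) * h0
      exact_mod_cast this
    · rw [Nat.div_lt_iff_lt_mul hq'0, ← hq']; exact ha
  · rintro ⟨a, b⟩ hab ⟨a', b'⟩ hab' heq
    simp only [Prod.mk.injEq] at heq
    obtain ⟨h1, h2⟩ := heq
    have hdvd : (q' : ℤ) ∣ a - a' := by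
      have h3 : (q' : ℤ) ∣ (a - a') * r' := ⟨b - b', by linear_combination h1⟩
      exact (Nat.isCoprime_iff_coprime.2 hcop).dvd_of_dvd_mul_right h3
    have hmod : a % q' = a' % q' := by
      have := (Int.emod_emod_of_dvd _ dvd_rfl : ((a:ℤ) % q') % q' = _)
      have h4 : (a' : ℤ) ≡ a [ZMOD q'] := Int.modEq_iff_dvd.2 hdvd
      exact ((Int.natCast_modEq_iff).1 h4).symm
    have haa : a = a' := by
      rw [← Nat.div_add_mod a q', ← Nat.div_add_mod a' q', h2, hmod]
    subst haa
    have : (b : ℤ) * q' = b' * q' := by linear_combination -h1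
    have : b * q' = b' * q' := by exact_mod_cast this
    rw [Nat.eq_of_mul_eq_mul_right hq'0 this]

def kgR (N : ℕ) : Finset (Σ _ : ℕ, ℕ) :=
  (Icc 1 N).sigma fun d => (range d).filter (fun a => d.Coprime a)

theorem kgR_mem {N : ℕ} {i : Σ _ : ℕ, ℕ} (h : i ∈ kgR N) :
    1 ≤ i.1 ∧ i.2 < i.1 ∧ i.1.Coprime i.2 := by
  simp only [kgR, Finset.mem_sigma, Finset.mem_Icc, Finset.mem_filter, Finset.mem_range] at h
  tauto

theorem kgR_ne {N : ℕ} {i j : Σ _ : ℕ, ℕ} (h : i ∈ kgR N) (h' : j ∈ kgR N) (hne : i ≠ j) :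
    i.2 * j.1 ≠ j.2 * i.1 := by
  intro h1
  obtain ⟨p1, -, p3⟩ := kgR_mem h
  obtain ⟨p1', -, p3'⟩ := kgR_mem h'
  have hd : i.1 ∣ j.1 := p3.dvd_of_dvd_mul_left ⟨j.2, by rw [h1]; ring⟩
  have hd' : j.1 ∣ i.1 := p3'.dvd_of_dvd_mul_left ⟨i.2, by rw [← h1]; ring⟩
  have he : i.1 = j.1 := Nat.dvd_antisymm hd hd'
  apply hne
  obtain ⟨d, a⟩ := i
  obtain ⟨d', a'⟩ := j
  simp only at he h1 p1
  subst he
  rw [Nat.eq_of_mul_eq_mul_right p1 h1]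

theorem kg_overlap (ρ : ℕ → ℝ) (hρ0 : ∀ q, 0 < ρ q) (q r a b : ℕ) (hq : 1 ≤ q) (hr : 1 ≤ r) :
    (volume : Measure ℝ).real (Metric.closedBall ((a : ℝ) / q) (ρ q / q) ∩
      Metric.closedBall ((b : ℝ) / r) (ρ r / r)) ≤
      if |(a : ℝ) * r - b * q| ≤ (ρ q / q + ρ r / r) * (q * r) then
        2 * min (ρ q / q) (ρ r / r) else 0 := by
  have hq0 : (0 : ℝ) < q := by exact_mod_cast hq
  have hr0 : (0 : ℝ) < r := by exact_mod_cast hr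
  have h1 : 0 < ρ q / q := div_pos (hρ0 _) hq0
  have h2 : 0 < ρ r / r := div_pos (hρ0 _) hr0
  have hvol : ∀ x c : ℝ, 0 < c → (volume : Measure ℝ).real (Metric.closedBall x c) = 2 * c := by
    intro x c hc
    rw [measureReal_def, Real.volume_closedBall, ENNReal.toReal_ofReal (by linarith)]
  split_ifs with h
  · rw [mul_min_of_nonneg _ _ (by norm_num : (0:ℝ) ≤ 2)]
    refine le_min ?_ ?_
    · rw [← hvol _ _ h1]
      exact measureReal_mono Set.inter_subset_left
        (by rw [Real.volume_closedBall]; exact ENNReal.ofReal_ne_top)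
    · rw [← hvol _ _ h2]
      exact measureReal_mono Set.inter_subset_right
        (by rw [Real.volume_closedBall]; exact ENNReal.ofReal_ne_top)
  · have : Metric.closedBall ((a : ℝ) / q) (ρ q / q) ∩
      Metric.closedBall ((b : ℝ) / r) (ρ r / r) = ∅ := by
      rw [Set.eq_empty_iff_forall_notMem]
      rintro x ⟨hx1, hx2⟩
      apply h
      rw [Metric.mem_closedBall, Real.dist_eq] at hx1 hx2
      have h3 : |(a : ℝ) / q - b / r| ≤ ρ q / q + ρ r / r := by
        have := abs_sub_le ((a : ℝ) / q) x (b / r)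
        rw [abs_sub_comm _ x] at this
        linarith
      have e : (a : ℝ) * r - b * q = ((a : ℝ) / q - b / r) * (q * r) := by field_simp
      rw [e, abs_mul, abs_of_pos (mul_pos hq0 hr0)]
      exact mul_le_mul_of_nonneg_right h3 (by positivity)
    rw [this]; simp

theorem kg_second (ρ : ℕ → ℝ) (hρ0 : ∀ q, 0 < ρ q) (q r : ℕ) (hq : 1 ≤ q) (hr : 1 ≤ r) :
    ∑ a ∈ (range q).filter (fun a => q.Coprime a), ∑ b ∈ (range r).filter (fun a => r.Coprime a),
      (if a * r ≠ b * q then (volume : Measure ℝ).real (Metric.closedBall ((a : ℝ) / q) (ρ q / q) ∩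
      Metric.closedBall ((b : ℝ) / r) (ρ r / r)) else 0) ≤ 8 * (ρ q * ρ r) := by
  have hq0 : (0 : ℝ) < q := by exact_mod_cast hq
  have hr0 : (0 : ℝ) < r := by exact_mod_cast hr
  have h1 : 0 < ρ q / q := div_pos (hρ0 _) hq0
  have h2 : 0 < ρ r / r := div_pos (hρ0 _) hr0
  have hnn : ∀ a b : ℕ, 0 ≤ (if a * r ≠ b * q then (volume : Measure ℝ).real
      (Metric.closedBall ((a : ℝ) / q) (ρ q / q) ∩
      Metric.closedBall ((b : ℝ) / r) (ρ r / r)) else 0) := by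
    intro a b; split_ifs <;> positivity
  set B : ℝ := (ρ q / q + ρ r / r) * (q * r) with hB
  have hB0 : 0 ≤ B := by positivity
  set w : ℝ := min (ρ q / q) (ρ r / r) with hw
  have hw0 : 0 < w := lt_min h1 h2
  calc _ ≤ ∑ a ∈ range q, ∑ b ∈ range r,
      (if a * r ≠ b * q then (volume : Measure ℝ).real (Metric.closedBall ((a : ℝ) / q) (ρ q / q) ∩
      Metric.closedBall ((b : ℝ) / r) (ρ r / r)) else 0) := by
        refine (Finset.sum_le_sum fun a _ => Finset.sum_le_sum_of_subset_of_nonneg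
          (Finset.filter_subset _ _) fun b _ _ => hnn a b).trans ?_
        exact Finset.sum_le_sum_of_subset_of_nonneg (Finset.filter_subset _ _)
          fun a _ _ => Finset.sum_nonneg fun b _ => hnn a b
    _ ≤ ∑ a ∈ range q, ∑ b ∈ range r,
        (if a * r ≠ b * q ∧ |(a : ℝ) * r - b * q| ≤ B then 2 * w else 0) := by
        refine Finset.sum_le_sum fun a _ => Finset.sum_le_sum fun b _ => ?_
        by_cases h : a * r ≠ b * q
        · simp only [h, not_false_eq_true, ne_eq, true_and, if_true]
          exact kg_overlap ρ hρ0 q r a b hq hr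
        · simp [h]
    _ = (((range q) ×ˢ (range r)).filter (fun p : ℕ × ℕ => p.1 * r ≠ p.2 * q ∧
      |(p.1 : ℝ) * r - p.2 * q| ≤ B)).card * (2 * w) := by
        rw [← Finset.sum_product' (f := fun a b : ℕ =>
          (if a * r ≠ b * q ∧ |(a : ℝ) * r - b * q| ≤ B then 2 * w else 0)), ← Finset.sum_filter,
          Finset.sum_const, nsmul_eq_mul]
    _ ≤ 2 * B * (2 * w) := mul_le_mul_of_nonneg_right (kg_count q r hq hr B hB0) (by positivity)
    _ = 4 * ((ρ q / q + ρ r / r) * w) * (q * r) := by rw [hB]; ring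
    _ ≤ 4 * (2 * (ρ q / q * (ρ r / r))) * (q * r) := by
        have : (ρ q / q + ρ r / r) * w ≤ 2 * (ρ q / q * (ρ r / r)) := by
          have h3 : w ≤ ρ q / q := min_le_left _ _
          have h4 : w ≤ ρ r / r := min_le_right _ _
          nlinarith
        gcongr
    _ = 8 * (ρ q * ρ r) := by field_simp; ring

theorem kg_dim_one (ψ : ℕ → ℝ) (hψ : ∀ q, 0 < ψ q) (hmono : Antitone ψ)
    (ρ : ℕ → ℝ) (hρa : Antitone ρ) (hρ0 : ∀ q, 0 < ρ q) (hρψ : ∀ q, ρ q < ψ q)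
    (hρ1 : ∀ q, ρ q ≤ 1 / 2)
    (hT : Tendsto (fun N : ℕ => ∑ d ∈ Icc 1 N, (d.totient : ℝ) / d * (d : ℝ) ^ 0 * ρ d)
      atTop atTop) :
    ∀ᵐ h : Fin 1 → ℝ, {pq : ℤ × (Fin 1 → ℤ) | pq.2 ≠ 0 ∧
        |(pq.1 : ℝ) + ∑ k, (pq.2 k : ℝ) * h k|
          < ψ (Finset.univ.sup fun k => (pq.2 k).natAbs)}.Infinite := by
  classical
  let A : (Σ _ : ℕ, ℕ) → Set ℝ := fun i =>
    if ∃ N, i ∈ kgR N then Metric.closedBall ((i.2 : ℝ) / i.1) (ρ i.1 / i.1) else ∅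
  have hA : ∀ i, MeasurableSet (A i) := by
    intro i
    simp only [A]; split_ifs
    · exact measurableSet_closedBall
    · exact MeasurableSet.empty
  have hAS : ∀ N, ∀ i ∈ kgR N, A i = Metric.closedBall ((i.2 : ℝ) / i.1) (ρ i.1 / i.1) := by
    intro N i hi
    exact if_pos ⟨N, hi⟩
  let μ : Measure ℝ := volume.restrict (Set.Icc (-1) 2)
  have hfin : IsFiniteMeasure μ := ⟨by simp [μ]⟩
  have hsub : ∀ N, ∀ i ∈ kgR N, A i ⊆ Set.Icc (-1) 2 := by
    intro N i hi x hx
    rw [hAS N i hi, Metric.mem_closedBall, Real.dist_eq, abs_le] at hx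
    obtain ⟨p1, p2, -⟩ := kgR_mem hi
    have hd : (1 : ℝ) ≤ i.1 := by exact_mod_cast p1
    have h1 : (i.2 : ℝ) / i.1 ≤ 1 := (div_le_one (by linarith)).2 (by exact_mod_cast p2.le)
    have h2 : 0 ≤ (i.2 : ℝ) / i.1 := by positivity
    have h3 : ρ i.1 / i.1 ≤ 1 := (div_le_one (by linarith)).2 (by linarith [hρ1 i.1])
    constructor <;> linarith
  have hμ : ∀ N, ∀ i ∈ kgR N, ∀ D, μ.real (A i ∩ D) = volume.real (A i ∩ D) := by
    intro N i hi D
    rw [measureReal_restrict_apply' measurableSet_Icc]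
    rw [Set.inter_eq_left.2 (Set.inter_subset_left.trans (hsub N i hi))]
  have hA1 : ∀ N, ∀ i ∈ kgR N, μ.real (A i) = 2 * (ρ i.1 / i.1) := by
    intro N i hi
    rw [← Set.inter_univ (A i), hμ N i hi, Set.inter_univ, hAS N i hi, measureReal_def,
      Real.volume_closedBall, ENNReal.toReal_ofReal]
    have := (hρ0 i.1).le
    positivity
  have hsum : ∀ N, ∑ i ∈ kgR N, μ.real (A i) =
      2 * ∑ d ∈ Icc 1 N, (d.totient : ℝ) / d * (d : ℝ) ^ 0 * ρ d := by
    intro N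
    rw [Finset.sum_congr rfl (hA1 N), kgR, Finset.sum_sigma, Finset.mul_sum]
    refine Finset.sum_congr rfl fun d hd => ?_
    simp only [Finset.sum_const, nsmul_eq_mul]
    rw [← Nat.totient_eq_card_coprime]
    ring
  have hoff : ∀ N, ∑ i ∈ kgR N, ∑ j ∈ kgR N, (if i.2 * j.1 ≠ j.2 * i.1 then μ.real (A i ∩ A j) else 0)
      ≤ 8 * (∑ d ∈ Icc 1 N, ρ d) ^ 2 := by
    intro N
    have e1 : ∑ i ∈ kgR N, ∑ j ∈ kgR N, (if i.2 * j.1 ≠ j.2 * i.1 then μ.real (A i ∩ A j) else 0) =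
        ∑ i ∈ kgR N, ∑ j ∈ kgR N, (if i.2 * j.1 ≠ j.2 * i.1 then
          (volume : Measure ℝ).real (Metric.closedBall ((i.2 : ℝ) / i.1) (ρ i.1 / i.1) ∩
            Metric.closedBall ((j.2 : ℝ) / j.1) (ρ j.1 / j.1)) else 0) := by
      refine Finset.sum_congr rfl fun i hi => Finset.sum_congr rfl fun j hj => ?_
      rw [hμ N i hi, hAS N i hi, hAS N j hj]
    rw [e1, kgR, Finset.sum_sigma]
    simp only [Finset.sum_sigma]
    rw [sq, Finset.sum_mul_sum, Finset.mul_sum]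
    refine Finset.sum_le_sum fun q hq => ?_
    rw [Finset.sum_comm, Finset.mul_sum]
    refine Finset.sum_le_sum fun r hr => ?_
    exact kg_second ρ hρ0 q r (Finset.mem_Icc.1 hq).1 (Finset.mem_Icc.1 hr).1
  obtain ⟨S, -, hSs, hS⟩ := kg_second_moment μ A hA kgR 32 (by norm_num)
    (by simp only [hsum]; exact hT.const_mul_atTop two_pos) (by
      intro N
      have h1 : ∑ i ∈ kgR N, ∑ j ∈ kgR N, μ.real (A i ∩ A j) ≤
          ∑ i ∈ kgR N, ∑ j ∈ kgR N, ((if i.2 * j.1 ≠ j.2 * i.1 then μ.real (A i ∩ A j) else 0) +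
            if i = j then μ.real (A i) else 0) := by
        refine Finset.sum_le_sum fun i hi => Finset.sum_le_sum fun j hj => ?_
        by_cases hij : i = j
        · subst hij; simp
        · simp [kgR_ne hi hj hij, hij]
      refine h1.trans ?_
      simp only [Finset.sum_add_distrib]
      have h2 : ∑ i ∈ kgR N, ∑ j ∈ kgR N, (if i = j then μ.real (A i) else 0) =
          ∑ i ∈ kgR N, μ.real (A i) := by
        refine Finset.sum_congr rfl fun i hi => ?_
        rw [Finset.sum_ite_eq, if_pos hi]
      rw [h2]
      have h3 := hoff N
      have h4 := kg_tot4 0 ρ hρa (fun q => (hρ0 q).le) N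
      have h5 := hsum N
      have h6 : 0 ≤ ∑ d ∈ Icc 1 N, ρ d := Finset.sum_nonneg fun d _ => (hρ0 d).le
      have h7 : ∑ d ∈ Icc 1 N, ρ d ≤ 2 * ∑ i ∈ kgR N, μ.real (A i) := by
        rw [h5]
        have : ∑ m ∈ Icc 1 N, (m : ℝ) ^ 0 * ρ m = ∑ m ∈ Icc 1 N, ρ m := by simp
        rw [this] at h4
        linarith
      have h8 := pow_le_pow_left₀ h6 h7 2
      nlinarith)
  have hWA : ∀ x : ℝ, {i | x ∈ A i}.Infinite →
      (x : UnitAddCircle) ∈ addWellApproximable UnitAddCircle (fun n => ψ n / n) := by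
    intro x hx
    rw [UnitAddCircle.mem_addWellApproximable_iff]
    by_contra hcon
    rw [Set.not_infinite] at hcon
    apply hx
    refine ((hcon.biUnion (t := fun n => (fun a => (⟨n, a⟩ : Σ _ : ℕ, ℕ)) '' ((range n : Finset ℕ) : Set ℕ))
      (fun n _ => (Finset.finite_toSet _).image _))).subset ?_
    rintro ⟨d, a⟩ hi
    have hex : ∃ N, (⟨d, a⟩ : Σ _ : ℕ, ℕ) ∈ kgR N := by
      by_contra hcon
      simp [A, hcon] at hi
    obtain ⟨N, hN⟩ := hex
    obtain ⟨p1, p2, p3⟩ := kgR_mem hN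
    simp only at p1 p2 p3
    rw [Set.mem_ofPred_eq, hAS N _ hN, Metric.mem_closedBall, Real.dist_eq] at hi
    simp only [Set.mem_iUnion, Set.mem_image, Finset.mem_coe, Finset.mem_range]
    refine ⟨d, ⟨a, p2, p3.symm, ?_⟩, a, p2, rfl⟩
    have hd : (0 : ℝ) < d := by exact_mod_cast p1
    rw [← QuotientAddGroup.mk_sub]
    calc ‖((x - (a : ℝ) / d : ℝ) : UnitAddCircle)‖ ≤ |x - (a : ℝ) / d| := by
          rw [UnitAddCircle.norm_eq]
          simpa using round_le (x - (a : ℝ) / d) 0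
      _ ≤ ρ d / d := hi
      _ < ψ d / d := div_lt_div_of_pos_right (hρψ d) hd
  have hδ : Tendsto (fun n : ℕ => ψ n / n) atTop (𝓝 0) := by
    refine squeeze_zero (fun n => div_nonneg (hψ n).le n.cast_nonneg)
      (fun n => div_le_div_of_nonneg_right (hmono (Nat.zero_le n)) n.cast_nonneg)
      (tendsto_const_div_atTop_nhds_zero_nat (ψ 0))
  have hae : ∀ᵐ x : UnitAddCircle, x ∈ addWellApproximable UnitAddCircle (fun n => ψ n / n) := by
    rcases AddCircle.addWellApproximable_ae_empty_or_univ (T := 1) _ hδ with h | h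
    · exfalso
      have h0 : ∀ t : ℤ, ∀ᵐ x : ℝ ∂(volume.restrict (Set.Ioc (t : ℝ) (t + 1))),
          (x : UnitAddCircle) ∉ addWellApproximable UnitAddCircle (fun n => ψ n / n) := fun t =>
        (AddCircle.measurePreserving_mk 1 (t : ℝ)).quasiMeasurePreserving.ae h
      have h1 : ∀ᵐ x : ℝ,
          (x : UnitAddCircle) ∉ addWellApproximable UnitAddCircle (fun n => ψ n / n) := by
        simp only [ae_restrict_iff' measurableSet_Ioc] at h0
        filter_upwards [ae_all_iff.2 h0] with x hx
        refine hx (⌈x⌉ - 1) ?_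
        push_cast
        exact ⟨by linarith [Int.ceil_lt_add_one x], by linarith [Int.le_ceil x]⟩
      have h2 : volume S = 0 := by
        refine measure_mono_null ?_ (ae_iff.1 h1)
        intro x hx
        simpa using hWA x (hSs hx)
      have h3 : μ S = 0 := Measure.absolutelyContinuous_restrict h2
      rw [measureReal_def, h3] at hS
      norm_num at hS
    · exact h
  have hae1 : ∀ᵐ x : Fin 1 → UnitAddCircle,
      x 0 ∈ addWellApproximable UnitAddCircle (fun n => ψ n / n) := by
    have := (Measure.quasiMeasurePreserving_eval (fun _ : Fin 1 => (volume : Measure UnitAddCircle)) 0).ae hae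
    exact this
  filter_upwards [kg_transfer 1 _ hae1] with y hy
  rw [UnitAddCircle.mem_addWellApproximable_iff] at hy
  have hmem : ∀ n ∈ {n : ℕ | ∃ m < n, gcd m n = 1 ∧ ‖(y 0 : UnitAddCircle) - ↑((m : ℝ) / n)‖ < ψ n / n},
      ∃ p : ℤ, (p, fun _ => (n : ℤ)) ∈ {pq : ℤ × (Fin 1 → ℤ) | pq.2 ≠ 0 ∧
        |(pq.1 : ℝ) + ∑ k, (pq.2 k : ℝ) * y k|
          < ψ (Finset.univ.sup fun k => (pq.2 k).natAbs)} := by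
    rintro n ⟨m, hm, -, hn⟩
    rw [← QuotientAddGroup.mk_sub] at hn
    obtain ⟨p, hp⟩ := kg_norm _ _ hn
    have hn0 : (0 : ℝ) < n := by
      have : 0 < n := by omega
      exact_mod_cast this
    refine ⟨p * n - m, ?_, ?_⟩
    · intro h0
      have : (n : ℤ) = 0 := congrFun h0 0
      omega
    · simp only [Finset.univ_unique, Finset.sup_singleton, Int.natAbs_natCast, Finset.sum_singleton]
      rw [lt_div_iff₀ hn0, ← abs_of_pos hn0, ← abs_mul, abs_of_pos hn0] at hp
      have e : (p + (y 0 - (m : ℝ) / n)) * n = p * n + (y 0 * n - (m : ℝ) / n * n) := by ring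
      rw [e, div_mul_cancel₀ _ hn0.ne'] at hp
      have e2 : ((p * n - m : ℤ) : ℝ) + ((n : ℤ) : ℝ) * y 0 = p * n + (y 0 * n - m) := by
        push_cast; ring
      rw [← e2] at hp
      exact hp
  choose! p hp using hmem
  refine Set.infinite_of_injOn_mapsTo (f := fun n => (p n, fun _ => (n : ℤ))) ?_ hp hy
  intro i _ j _ hij
  have := congrFun (Prod.ext_iff.1 hij).2 0
  have h1 : (i : ℤ) = j := this
  exact_mod_cast h1

theorem stmt15 (K : ℕ) (hK : 2 ≤ K) (ψ : ℕ → ℝ) (hψ : ∀ q, 0 < ψ q)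
    (hmono : Antitone ψ)
    (hdiv : ¬ Summable (fun q : ℕ => (q : ℝ) ^ (K - 2) * ψ q)) :
    MeasureTheory.volume {h : Fin (K - 1) → ℝ |
      {pq : ℤ × (Fin (K - 1) → ℤ) | pq.2 ≠ 0 ∧
        |(pq.1 : ℝ) + ∑ k, (pq.2 k : ℝ) * h k|
          < ψ (Finset.univ.sup fun k => (pq.2 k).natAbs)}.Infinite}ᶜ = 0 := by
  obtain ⟨ρ, hρa, hρ0, hρψ, hρ1, hT⟩ := kg_trunc (K - 2) ψ hψ hmono hdiv
  obtain ⟨m, rfl⟩ : ∃ m, K = m + 2 := ⟨K - 2, by omega⟩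
  rw [Nat.add_sub_cancel] at hT
  rcases m with _ | m
  · exact ae_iff.1 (kg_dim_one ψ hψ hmono ρ hρa hρ0 hρψ hρ1 hT)
  · exact ae_iff.1 (kg_ge_two m ψ ρ hρ0 hρψ hρ1 hT)
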